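/- Let X be a separated metric compact Hausdorff space whose metric d never attains the value ∞. Then the topology of X coincides with the topology symmetrically induced by d if and only if the function (x, y) ↦ d x y is continuous from X × X to ℝ≥0∞ (with its order topology). -/

import Mathlib

open ENNReal

/-- `d` is a (Lawvere-style) metric: `d x x = 0` and the triangle inequality holds. -/
def IsEMetric {X : Type*} (d : X → X → ℝ≥0∞) : Prop :=
  (∀ x, d x x = 0) ∧ ∀ x y z, d x z ≤ d x y + d y z

/-- `d` is separated: `d x y = 0` and `d y x = 0` imply `x = y`. -/
def IsSepMetric {X : Type*} (d : X → X → ℝ≥0∞) : Prop :=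
  ∀ x y, d x y = 0 → d y x = 0 → x = y

/-- The topology symmetrically induced by `d`, generated by the right and left open balls. -/
def symTopology {X : Type*} (d : X → X → ℝ≥0∞) : TopologicalSpace X :=
  TopologicalSpace.generateFrom
    {s | ∃ x₀ u, s = {x | d x₀ x < u} ∨ s = {x | d x x₀ < u}}

open scoped Topology

theorem IsEMetric.upperSemicontinuous {X : Type*} [TopologicalSpace X] {d : X → X → ℝ≥0∞}
    (hmet : IsEMetric d)
    (hright : ∀ x₀ u, IsOpen {x | d x₀ x < u}) (hleft : ∀ x₀ u, IsOpen {x | d x x₀ < u}) :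
    UpperSemicontinuous (fun p : X × X => d p.1 p.2) := by
  rintro ⟨a, b⟩ c hc
  obtain ⟨ε, hε, hεc⟩ : ∃ ε, 0 < ε ∧ d a b + (ε + ε) < c := by
    obtain ⟨e, he, hec⟩ := ENNReal.lt_iff_exists_add_pos_lt.1 hc
    refine ⟨(e : ℝ≥0∞) / 2, ENNReal.half_pos (by exact_mod_cast he.ne'), ?_⟩
    rwa [ENNReal.add_halves]
  have ha : ∀ᶠ x in nhds a, d x a < ε := (hleft a ε).mem_nhds (by simpa [hmet.1 a] using hε)
  have hb : ∀ᶠ y in nhds b, d b y < ε := (hright b ε).mem_nhds (by simpa [hmet.1 b] using hε)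
  rw [nhds_prod_eq]
  filter_upwards [ha.prod_mk hb] with p hp
  calc d p.1 p.2 ≤ d p.1 a + (d a b + d b p.2) :=
        (hmet.2 _ a _).trans (by gcongr; exact hmet.2 _ _ _)
    _ ≤ ε + (d a b + ε) := by gcongr; exacts [hp.1.le, hp.2.le]
    _ = d a b + (ε + ε) := by ring
    _ < c := hεc

theorem isOpen_symTopology_right {X : Type*} (d : X → X → ℝ≥0∞) (x₀ : X) (u : ℝ≥0∞) :
    IsOpen[symTopology d] {x | d x₀ x < u} :=
  TopologicalSpace.isOpen_generateFrom_of_mem ⟨x₀, u, Or.inl rfl⟩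

theorem isOpen_symTopology_left {X : Type*} (d : X → X → ℝ≥0∞) (x₀ : X) (u : ℝ≥0∞) :
    IsOpen[symTopology d] {x | d x x₀ < u} :=
  TopologicalSpace.isOpen_generateFrom_of_mem ⟨x₀, u, Or.inr rfl⟩

theorem t2Space_symTopology {X : Type*} {d : X → X → ℝ≥0∞} (hmet : IsEMetric d)
    (hsep : IsSepMetric d) : @T2Space X (symTopology d) := by
  let _ := symTopology d
  have key : ∀ x y, d x y ≠ 0 →
      ∃ u v : Set X, IsOpen u ∧ IsOpen v ∧ x ∈ u ∧ y ∈ v ∧ Disjoint u v := by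
    intro x y h
    have hpos : 0 < d x y / 2 := ENNReal.half_pos h
    refine ⟨{z | d x z < d x y / 2}, {z | d z y < d x y / 2}, isOpen_symTopology_right d _ _,
      isOpen_symTopology_left d _ _, by simpa [hmet.1 x] using h, by simpa [hmet.1 y] using h, ?_⟩
    refine Set.disjoint_left.2 fun z hz hz' => lt_irrefl (d x y) ?_
    calc d x y ≤ d x z + d z y := hmet.2 _ _ _
      _ < d x y / 2 + d x y / 2 := ENNReal.add_lt_add hz hz'
      _ = d x y := ENNReal.add_halves _
  refine ⟨fun x y hxy => ?_⟩
  by_cases h : d x y = 0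
  · obtain ⟨u, v, hu, hv, hy, hx, huv⟩ := key y x fun h' => hxy (hsep x y h h')
    exact ⟨v, u, hv, hu, hx, hy, huv.symm⟩
  · exact key x y h

theorem TopologicalSpace.eq_of_le_of_compactSpace_of_t2Space {X : Type*}
    {t s : TopologicalSpace X} (hle : t ≤ s) (ht : @CompactSpace X t) (hs : @T2Space X s) :
    t = s := by
  refine le_antisymm hle (continuous_id_iff_le.1 ?_)
  exact (@Continuous.continuous_symm_of_equiv_compact_to_t2 X X t s ht hs (Equiv.refl X)
    (continuous_id_iff_le.2 hle))

theorem stmt_1 {X : Type*} [t : TopologicalSpace X] [CompactSpace X] [T2Space X]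
    (d : X → X → ℝ≥0∞) (hmet : IsEMetric d) (hsep : IsSepMetric d)
    (hlsc : LowerSemicontinuous (fun p : X × X => d p.1 p.2))
    (hfin : ∀ x y, d x y ≠ ∞) :
    t = symTopology d ↔ Continuous (fun p : X × X => d p.1 p.2) := by
  constructor
  · intro h
    refine continuous_iff_lower_upperSemicontinuous.2
      ⟨hlsc, hmet.upperSemicontinuous (fun x₀ u => ?_) (fun x₀ u => ?_)⟩
    · exact h ▸ isOpen_symTopology_right d x₀ u
    · exact h ▸ isOpen_symTopology_left d x₀ u
  · intro hc
    refine TopologicalSpace.eq_of_le_of_compactSpace_of_t2Space (le_generateFrom ?_) ‹_›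
      (t2Space_symTopology hmet hsep)
    rintro _ ⟨x₀, u, rfl | rfl⟩
    · exact isOpen_lt (hc.comp (Continuous.prodMk_right x₀)) continuous_const
    · exact isOpen_lt (hc.comp (Continuous.prodMk_left x₀)) continuous_const
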